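/- arXiv:math/0606300 — 4 statements merged into one kernel-verified Lean document; each statement's English description precedes it below -/
import Mathlib

section
/- Let r, g > 0 and let R, G : ℝ → ℝ be differentiable functions satisfying R'(t) = -g·G(t) and G'(t) = -r·R(t) for all t. If r·R(0)² - g·G(0)² > 0, then for every t one has R(t)² ≥ (r·R(0)² - g·G(0)²)/r > 0; in particular R(t) ≠ 0 for all t, so only the G-side can ever be annihilated. -/
/-- Lanchester's square law: the difference of fighting strengths is conserved. -/
theorem lanchester_square_law {r g : ℝ} {R G : ℝ → ℝ}
    (hR : ∀ t, HasDerivAt R (-g * G t) t) (hG : ∀ t, HasDerivAt G (-r * R t) t) (s t : ℝ) :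
    r * R s ^ 2 - g * G s ^ 2 = r * R t ^ 2 - g * G t ^ 2 := by
  have hd : ∀ u, HasDerivAt (fun u => r * R u ^ 2 - g * G u ^ 2) 0 u := fun u => by
    refine ((((hR u).fun_pow 2).const_mul r).fun_sub
      (((hG u).fun_pow 2).const_mul g)).congr_deriv ?_
    push_cast
    ring
  exact is_const_of_deriv_eq_zero (fun u => (hd u).differentiableAt) (fun u => (hd u).deriv) s t

/-- In the Lanchester aimed-fire model with `r, g > 0`, if red's initial fighting
strength exceeds green's (`r R(0)² - g G(0)² > 0`), then `R(t)²` is bounded below by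
the positive constant `(r R(0)² - g G(0)²)/r` for all time; in particular `R` never
vanishes, so only the `G` side can ever be annihilated. -/
theorem lanchester_only_green_can_lose
    (r g : ℝ) (hr : 0 < r) (hg : 0 < g) (R G : ℝ → ℝ)
    (hR : Differentiable ℝ R) (hG : Differentiable ℝ G)
    (hR' : ∀ t, deriv R t = -g * G t)
    (hG' : ∀ t, deriv G t = -r * R t)
    (h0 : r * R 0 ^ 2 - g * G 0 ^ 2 > 0) :
    (r * R 0 ^ 2 - g * G 0 ^ 2) / r > 0 ∧
      ∀ t, R t ^ 2 ≥ (r * R 0 ^ 2 - g * G 0 ^ 2) / r ∧ R t ≠ 0 := by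
  have hpos := div_pos h0 hr
  refine ⟨hpos, fun t => ?_⟩
  have hcons := lanchester_square_law (fun u => hR' u ▸ (hR u).hasDerivAt)
    (fun u => hG' u ▸ (hG u).hasDerivAt) 0 t
  have hle : (r * R 0 ^ 2 - g * G 0 ^ 2) / r ≤ R t ^ 2 := by
    rw [div_le_iff₀ hr]
    nlinarith [mul_nonneg hg.le (sq_nonneg (G t))]
  exact ⟨hle, fun hz => by simp only [hz] at hle; linarith⟩
end

section
/- Let r, g > 0 and R₀ > 0, G₀ > 0 with r·R₀² > g·G₀². Let R(t) = R₀·cosh(√(rg)·t) - √(g/r)·G₀·sinh(√(rg)·t) and G(t) = G₀·cosh(√(rg)·t) - √(r/g)·R₀·sinh(√(rg)·t) be the solution of the Lanchester aimed-fire equations with these initial values. Then there exists T > 0 such that G(T) = 0, G(t) > 0 for all t ∈ [0, T), and R(T) = √(R₀² - (g/r)·G₀²) > 0; that is, the R-side wins the battle with √(R₀² - (g/r)·G₀²) units remaining. -/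
/-- In the Lanchester aimed-fire model with `r R₀² > g G₀²` (and positive initial
numbers), the explicit hyperbolic solution has a first time `T > 0` at which the
green force is annihilated, the green force being positive before `T`, and the red
force then has `√(R₀² - (g/r) G₀²) > 0` units remaining: red wins. -/
theorem lanchester_red_wins
    (r g : ℝ) (hr : 0 < r) (hg : 0 < g) (R₀ G₀ : ℝ) (hR₀ : 0 < R₀) (hG₀ : 0 < G₀)
    (hwin : r * R₀ ^ 2 > g * G₀ ^ 2) (R G : ℝ → ℝ)
    (hRdef : ∀ t, R t = R₀ * Real.cosh (Real.sqrt (r * g) * t)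
        - Real.sqrt (g / r) * G₀ * Real.sinh (Real.sqrt (r * g) * t))
    (hGdef : ∀ t, G t = G₀ * Real.cosh (Real.sqrt (r * g) * t)
        - Real.sqrt (r / g) * R₀ * Real.sinh (Real.sqrt (r * g) * t)) :
    ∃ T > 0, G T = 0 ∧ (∀ t, 0 ≤ t → t < T → 0 < G t) ∧
      R T = Real.sqrt (R₀ ^ 2 - (g / r) * G₀ ^ 2) ∧ 0 < R T := by
  set ω := Real.sqrt (r * g)
  set s := Real.sqrt (r / g)
  set k := Real.sqrt (g / r)
  have hω : 0 < ω := Real.sqrt_pos.2 (by positivity)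
  have hs : 0 < s := Real.sqrt_pos.2 (by positivity)
  have hk : 0 < k := Real.sqrt_pos.2 (by positivity)
  have hs2 : s ^ 2 = r / g := Real.sq_sqrt (by positivity)
  have hk2 : k ^ 2 = g / r := Real.sq_sqrt (by positivity)
  have hks : k * s = 1 := by
    have h : (k * s) ^ 2 = 1 := by
      rw [mul_pow, hs2, hk2]
      field_simp
    exact (pow_eq_one_iff_of_nonneg (by positivity) two_ne_zero).1 h
  have hpos : 0 < (s * R₀) ^ 2 - G₀ ^ 2 := by
    have h : (s * R₀) ^ 2 - G₀ ^ 2 = (r * R₀ ^ 2 - g * G₀ ^ 2) / g := by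
      rw [mul_pow, hs2]
      field_simp
    rw [h]
    exact div_pos (sub_pos.2 hwin) hg
  obtain ⟨D, hD, hD2⟩ : ∃ D : ℝ, 0 < D ∧ D ^ 2 = (s * R₀) ^ 2 - G₀ ^ 2 :=
    ⟨_, Real.sqrt_pos.2 hpos, Real.sq_sqrt hpos.le⟩
  obtain ⟨w, hw⟩ : ∃ w, Real.sinh w = G₀ / D := ⟨_, Real.sinh_arsinh _⟩
  have hw0 : 0 < w := Real.sinh_pos_iff.1 (hw ▸ by positivity)
  have hsinh : G₀ = D * Real.sinh w := by
    rw [hw]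
    field_simp
  have hcosh : s * R₀ = D * Real.cosh w := by
    refine (pow_left_inj₀ (by positivity) (mul_pos hD (Real.cosh_pos w)).le two_ne_zero).1 ?_
    rw [mul_pow D, Real.cosh_sq, mul_add, ← mul_pow, ← hsinh, hD2]
    ring
  have hG : ∀ t, G t = D * Real.sinh (w - ω * t) := by
    intro t
    rw [hGdef, hcosh, Real.sinh_sub]
    nth_rewrite 1 [hsinh]
    ring
  have hR : ∀ t, R t = k * D * Real.cosh (w - ω * t) := by
    intro t
    have h : R₀ = k * (D * Real.cosh w) := by
      rw [← hcosh, ← mul_assoc, hks, one_mul]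
    rw [hRdef, Real.cosh_sub, h, hsinh]
    ring
  have hT : w - ω * (w / ω) = 0 := by
    field_simp
    ring
  have hRT : R (w / ω) = k * D := by
    rw [hR, hT, Real.cosh_zero, mul_one]
  refine ⟨w / ω, by positivity, ?_, ?_, ?_, ?_⟩
  · rw [hG, hT, Real.sinh_zero, mul_zero]
  · intro t _ ht
    rw [hG]
    rw [lt_div_iff₀ hω] at ht
    exact mul_pos hD (Real.sinh_pos_iff.2 (by linarith))
  · have h : R₀ ^ 2 - g / r * G₀ ^ 2 = (k * D) ^ 2 := by
      rw [← hk2]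
      linear_combination -k ^ 2 * hD2 - R₀ ^ 2 * (k * s + 1) * hks
    rw [hRT, h, Real.sqrt_sq (by positivity)]
  · rw [hRT]
    positivity
end

section
/- Let r, g₁, g₂ be real constants and let R, G₁, G₂ : ℝ → ℝ be differentiable functions with G(t) = G₁(t) + G₂(t) ≠ 0 for all t, satisfying the mixed-force Lanchester equations R'(t) = -g₁·G₁(t) - g₂·G₂(t), G₁'(t) = -r·R(t)·G₁(t)/G(t), and G₂'(t) = -r·R(t)·G₂(t)/G(t). Then the quantity r·R(t)² - (g₁·G₁(t) + g₂·G₂(t))·(G₁(t) + G₂(t)) is constant in t; equivalently, r·R² - g_ave·G² is conserved, where g_ave = (g₁G₁ + g₂G₂)/G is the average effectiveness of the mixed green force. -/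
/-- In the mixed-force Lanchester model, where the green side consists of two unit
types `G₁, G₂` with effectiveness `g₁, g₂` and red's fire is distributed among
green units in proportion to their numbers, the quantity
`r R² - (g₁ G₁ + g₂ G₂)(G₁ + G₂)`, i.e. `r R² - g_ave G²` with
`g_ave = (g₁ G₁ + g₂ G₂)/G` the average effectiveness, is constant in time. -/
theorem lanchester_mixed_forces_conserved
    (r g₁ g₂ : ℝ) (R G₁ G₂ : ℝ → ℝ)
    (hR : Differentiable ℝ R) (hG₁ : Differentiable ℝ G₁) (hG₂ : Differentiable ℝ G₂)
    (hGne : ∀ t, G₁ t + G₂ t ≠ 0)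
    (hR' : ∀ t, deriv R t = -g₁ * G₁ t - g₂ * G₂ t)
    (hG₁' : ∀ t, deriv G₁ t = -r * R t * G₁ t / (G₁ t + G₂ t))
    (hG₂' : ∀ t, deriv G₂ t = -r * R t * G₂ t / (G₁ t + G₂ t)) :
    ∀ t, r * R t ^ 2 - (g₁ * G₁ t + g₂ * G₂ t) * (G₁ t + G₂ t)
        = r * R 0 ^ 2 - (g₁ * G₁ 0 + g₂ * G₂ 0) * (G₁ 0 + G₂ 0) := by
  intro t
  refine is_const_of_deriv_eq_zero
    (f := fun s => r * R s ^ 2 - (g₁ * G₁ s + g₂ * G₂ s) * (G₁ s + G₂ s))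
    (by fun_prop) (fun s => ?_) t 0
  have dR := (hR s).hasDerivAt
  have d₁ := (hG₁ s).hasDerivAt
  have d₂ := (hG₂ s).hasDerivAt
  have d := ((dR.fun_pow 2).const_mul r).fun_sub
    (((d₁.const_mul g₁).fun_add (d₂.const_mul g₂)).fun_mul (d₁.fun_add d₂))
  rw [d.deriv, hR', hG₁', hG₂']
  have hG := hGne s
  field_simp
  ring
end

section
/- Let r, g, p, q be real constants with α = 1 + p - q ≠ 0, and let R, G : ℝ → ℝ be differentiable functions with R(t) > 0 and G(t) > 0 for all t, satisfying the generalized (Bracken) Lanchester equations R'(t) = -g·R(t)^q·G(t)^p and G'(t) = -r·R(t)^p·G(t)^q. Then the quantity g·G(t)^α - r·R(t)^α is constant in t. -/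
/-- In Bracken's generalized Lanchester model `R' = -g R^q G^p`, `G' = -r R^p G^q`
with positive force levels and `α = 1 + p - q ≠ 0`, the quantity `g G^α - r R^α`
is constant in time. (Powers of positive reals are real powers, `Real.rpow`.) -/
theorem bracken_generalized_conserved
    (r g p q : ℝ) (hα : 1 + p - q ≠ 0) (R G : ℝ → ℝ)
    (hRpos : ∀ t, 0 < R t) (hGpos : ∀ t, 0 < G t)
    (hR : Differentiable ℝ R) (hG : Differentiable ℝ G)
    (hR' : ∀ t, deriv R t = -g * R t ^ q * G t ^ p)
    (hG' : ∀ t, deriv G t = -r * R t ^ p * G t ^ q) :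
    ∀ t, g * G t ^ (1 + p - q) - r * R t ^ (1 + p - q)
        = g * G 0 ^ (1 + p - q) - r * R 0 ^ (1 + p - q) := by
  have cancel : ∀ x : ℝ, 0 < x → x ^ (1 + p - q - 1) * x ^ q = x ^ p := fun x hx => by
    rw [← Real.rpow_add hx]
    ring_nf
  have hderiv : ∀ t, HasDerivAt
      (fun t => g * G t ^ (1 + p - q) - r * R t ^ (1 + p - q)) 0 t := fun t => by
    have hGα := ((hG t).hasDerivAt.rpow_const (p := 1 + p - q)
      (Or.inl (hGpos t).ne')).const_mul g
    have hRα := ((hR t).hasDerivAt.rpow_const (p := 1 + p - q)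
      (Or.inl (hRpos t).ne')).const_mul r
    refine (hGα.sub hRα).congr_deriv ?_
    rw [hG', hR', ← cancel _ (hGpos t), ← cancel _ (hRpos t)]
    ring
  exact fun t => is_const_of_deriv_eq_zero (fun s => (hderiv s).differentiableAt)
    (fun s => (hderiv s).deriv) t 0
end
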